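/- Let a, b be positive real numbers. Then ∫_{x ∈ (0,1)} x^(a+2b-1) / √(1 - x^(2b)) dx = (a/(a+b)) · ∫_{x ∈ (0,1)} x^(a-1) / √(1 - x^(2b)) dx. -/

import Mathlib

theorem hasDerivAt_sqrt_one_sub_rpow {b x : ℝ} (hb : 0 < b) (hx : x ∈ Set.Ioo (0:ℝ) 1) :
    HasDerivAt (fun y : ℝ => Real.sqrt (1 - y ^ (2 * b)))
      (-(b * (x ^ (2 * b - 1) / Real.sqrt (1 - x ^ (2 * b))))) x := by
  have h1 : x ^ (2 * b) < 1 := Real.rpow_lt_one hx.1.le hx.2 (by positivity)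
  refine (((Real.hasDerivAt_rpow_const (p := 2 * b) (Or.inl hx.1.ne')).const_sub 1).sqrt
    (sub_pos.2 h1).ne').congr_deriv ?_
  have hs : Real.sqrt (1 - x ^ (2 * b)) ≠ 0 := (Real.sqrt_pos.2 (sub_pos.2 h1)).ne'
  field_simp

theorem continuous_sqrt_one_sub_rpow {b : ℝ} (hb : 0 < b) :
    Continuous fun y : ℝ => Real.sqrt (1 - y ^ (2 * b)) :=
  (continuous_const.sub (Real.continuous_rpow_const (by positivity))).sqrt

theorem intervalIntegrable_rpow_div_sqrt_one_sub_rpow {b : ℝ} (hb : 0 < b) :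
    IntervalIntegrable (fun x : ℝ => x ^ (2 * b - 1) / Real.sqrt (1 - x ^ (2 * b)))
      MeasureTheory.volume 0 1 := by
  rw [intervalIntegrable_iff_integrableOn_Ioc_of_le zero_le_one]
  refine intervalIntegral.integrableOn_deriv_of_nonneg
    (g := fun y : ℝ => -b⁻¹ * Real.sqrt (1 - y ^ (2 * b)))
    ((continuous_sqrt_one_sub_rpow hb).const_mul _).continuousOn (fun x hx => ?_) (fun x hx => ?_)
  · refine ((hasDerivAt_sqrt_one_sub_rpow hb hx).const_mul (-b⁻¹)).congr_deriv ?_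
    field_simp
  · have := hx.1
    positivity

theorem rpow_add_two_mul_sub_one_div_sqrt {a b x : ℝ} (hx : 0 < x) :
    x ^ (a + 2 * b - 1) / Real.sqrt (1 - x ^ (2 * b)) =
      x ^ a * (x ^ (2 * b - 1) / Real.sqrt (1 - x ^ (2 * b))) := by
  rw [add_sub_assoc, Real.rpow_add hx, mul_div_assoc]

theorem rpow_sub_one_div_sqrt {a b x : ℝ} (hb : 0 < b) (hx : x ∈ Set.Ioo (0:ℝ) 1) :
    x ^ (a - 1) / Real.sqrt (1 - x ^ (2 * b)) =
      x ^ (a - 1) * Real.sqrt (1 - x ^ (2 * b)) +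
        x ^ (a + 2 * b - 1) / Real.sqrt (1 - x ^ (2 * b)) := by
  have h1 : 0 < 1 - x ^ (2 * b) :=
    sub_pos.2 (Real.rpow_lt_one hx.1.le hx.2 (by positivity))
  have hs : Real.sqrt (1 - x ^ (2 * b)) ≠ 0 := (Real.sqrt_pos.2 h1).ne'
  rw [show a + 2 * b - 1 = (a - 1) + 2 * b by ring, Real.rpow_add hx.1]
  field_simp
  rw [Real.sq_sqrt h1.le]
  ring

theorem euler_integral_reduction
    (a b : ℝ) (ha : 0 < a) (hb : 0 < b) :
    ∫ x in Set.Ioo (0:ℝ) 1, x ^ (a + 2 * b - 1) / Real.sqrt (1 - x ^ (2 * b)) =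
      (a / (a + b)) * ∫ x in Set.Ioo (0:ℝ) 1, x ^ (a - 1) / Real.sqrt (1 - x ^ (2 * b)) := by
  have hI : IntervalIntegrable (fun x : ℝ => x ^ (a + 2 * b - 1) / Real.sqrt (1 - x ^ (2 * b)))
      MeasureTheory.volume 0 1 := by
    refine ((intervalIntegrable_rpow_div_sqrt_one_sub_rpow hb).continuousOn_mul
      (Real.continuous_rpow_const ha.le).continuousOn).congr fun x hx => ?_
    rw [Set.uIoc_of_le zero_le_one] at hx
    exact (rpow_add_two_mul_sub_one_div_sqrt hx.1).symm
  have hK : IntervalIntegrable (fun x : ℝ => x ^ (a - 1) * Real.sqrt (1 - x ^ (2 * b)))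
      MeasureTheory.volume 0 1 :=
    (intervalIntegral.intervalIntegrable_rpow' (by linarith)).mul_continuousOn
      (continuous_sqrt_one_sub_rpow hb).continuousOn
  have hJ : ∫ x in Set.Ioo (0:ℝ) 1, x ^ (a - 1) / Real.sqrt (1 - x ^ (2 * b)) =
      (∫ x in (0:ℝ)..1, x ^ (a - 1) * Real.sqrt (1 - x ^ (2 * b))) +
        ∫ x in (0:ℝ)..1, x ^ (a + 2 * b - 1) / Real.sqrt (1 - x ^ (2 * b)) := by
    rw [← intervalIntegral.integral_add hK hI, intervalIntegral.integral_of_le zero_le_one,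
      MeasureTheory.integral_Ioc_eq_integral_Ioo]
    exact MeasureTheory.setIntegral_congr_fun measurableSet_Ioo
      fun x hx => rpow_sub_one_div_sqrt hb hx
  have hFTC := intervalIntegral.integral_eq_sub_of_hasDerivAt_of_le
    (f := fun x : ℝ => x ^ a * Real.sqrt (1 - x ^ (2 * b)))
    (f' := fun x : ℝ => a * (x ^ (a - 1) * Real.sqrt (1 - x ^ (2 * b))) -
      b * (x ^ (a + 2 * b - 1) / Real.sqrt (1 - x ^ (2 * b)))) zero_le_one
    ((Real.continuous_rpow_const ha.le).mul (continuous_sqrt_one_sub_rpow hb)).continuousOn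
    (fun x hx => by
      refine ((Real.hasDerivAt_rpow_const (p := a) (Or.inl hx.1.ne')).mul
        (hasDerivAt_sqrt_one_sub_rpow hb hx)).congr_deriv ?_
      rw [rpow_add_two_mul_sub_one_div_sqrt hx.1]
      ring)
    ((hK.const_mul a).sub (hI.const_mul b))
  rw [intervalIntegral.integral_sub (hK.const_mul a) (hI.const_mul b),
    intervalIntegral.integral_const_mul, intervalIntegral.integral_const_mul] at hFTC
  simp only [Real.one_rpow, sub_self, Real.sqrt_zero, mul_zero, Real.zero_rpow ha.ne',
    zero_mul] at hFTC
  rw [hJ, ← MeasureTheory.integral_Ioc_eq_integral_Ioo,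
    ← intervalIntegral.integral_of_le zero_le_one]
  field_simp
  linarith
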